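/- arXiv:2003.06624 — 2 statements merged into one kernel-verified Lean document; each statement's English description precedes it below -/
import Mathlib

section
/- Let G and H be finite groups with coprime orders, i.e. gcd(|G|,|H|) = 1. If the direct product G × H is a BCI-group, then both G and H are BCI-groups. -/
open SimpleGraph

/-- The bi-Cayley graph `BCay(G,S)`: vertex set `G × {1,2}` (encoded as `G × Fin 2`,
where index `0` stands for part `1` and index `1` for part `2`), with edges
`{(g,1),(sg,2)}` for `g ∈ G`, `s ∈ S`. -/
def BCay (G : Type*) [Group G] (S : Set G) : SimpleGraph (G × Fin 2) :=
  SimpleGraph.fromRel (fun u v => u.2 = 0 ∧ v.2 = 1 ∧ v.1 * u.1⁻¹ ∈ S)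

/-- `BCay(G,S)` is a BCI-graph. -/
def IsBCIGraph (G : Type*) [Group G] (S : Set G) : Prop :=
  ∀ T : Set G, Nonempty (BCay G S ≃g BCay G T) →
    ∃ (g : G) (α : G ≃* G), T = (fun s => g * α s) '' S

/-- `G` is a BCI-group. -/
def IsBCIGroup (G : Type*) [Group G] : Prop :=
  ∀ S : Set G, IsBCIGraph G S

/-- `G` is an `m`-BCI-group. -/
def IsmBCIGroup (G : Type*) [Group G] (m : ℕ) : Prop :=
  ∀ S : Set G, S.ncard ≤ m → IsBCIGraph G S

/-- The Cayley graph `Cay(G,S)`, for `1 ∉ S = S⁻¹`. -/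
def Cay (G : Type*) [Group G] (S : Set G) : SimpleGraph G :=
  SimpleGraph.fromRel (fun x y => y * x⁻¹ ∈ S)

/-- `Cay(G,S)` is a CI-graph. -/
def IsCIGraph (G : Type*) [Group G] (S : Set G) : Prop :=
  ∀ T : Set G, 1 ∉ T → T⁻¹ = T → Nonempty (Cay G S ≃g Cay G T) →
    ∃ α : G ≃* G, T = α '' S

/-- `G` is a CI-group. -/
def IsCIGroup (G : Type*) [Group G] : Prop :=
  ∀ S : Set G, 1 ∉ S → S⁻¹ = S → IsCIGraph G S

/-- `G` is an `m`-CI-group. -/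
def IsmCIGroup (G : Type*) [Group G] (m : ℕ) : Prop :=
  ∀ S : Set G, 1 ∉ S → S⁻¹ = S → S.ncard ≤ m → IsCIGraph G S

theorem BCay_adj {G : Type*} [Group G] (S : Set G) (u v : G × Fin 2) :
    (BCay G S).Adj u v ↔
      (u.2 = 0 ∧ v.2 = 1 ∧ v.1 * u.1⁻¹ ∈ S) ∨ (v.2 = 0 ∧ u.2 = 1 ∧ u.1 * v.1⁻¹ ∈ S) := by
  rw [BCay, SimpleGraph.fromRel_adj, and_iff_right_iff_imp]
  rintro (⟨h0, h1, -⟩ | ⟨h0, h1, -⟩) rfl <;> simp [h0] at h1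

/-- `BCay (G × H) (S × {1})` is a disjoint union of copies of `BCay G S`, indexed by `H`. -/
theorem BCay_prod_one_adj {G H : Type*} [Group G] [Group H] (S : Set G)
    (u v : (G × H) × Fin 2) :
    (BCay (G × H) (S ×ˢ {1})).Adj u v ↔
      (BCay G S).Adj (u.1.1, u.2) (v.1.1, v.2) ∧ u.1.2 = v.1.2 := by
  simp only [BCay_adj, Set.mem_prod, Prod.fst_mul, Prod.snd_mul, Prod.fst_inv, Prod.snd_inv,
    Set.mem_singleton_iff, mul_inv_eq_one, eq_comm (a := v.1.2)]
  tauto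

/-- An isomorphism of bi-Cayley graphs over `G`, applied to every copy of the graph in the
bi-Cayley graph over `G × H`. -/
def BCay.isoProdOne {G : Type*} (H : Type*) [Group G] [Group H] {S T : Set G}
    (f : BCay G S ≃g BCay G T) :
    BCay (G × H) (S ×ˢ {1}) ≃g BCay (G × H) (T ×ˢ {1}) where
  toFun u := (((f (u.1.1, u.2)).1, u.1.2), (f (u.1.1, u.2)).2)
  invFun u := (((f.symm (u.1.1, u.2)).1, u.1.2), (f.symm (u.1.1, u.2)).2)
  left_inv u := by simp
  right_inv u := by simp
  map_rel_iff' := by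
    intro u v
    simp [BCay_prod_one_adj, f.map_adj_iff]

/-- The isomorphism of bi-Cayley graphs induced by a group isomorphism. -/
def BCay.isoPreimage {G K : Type*} [Group G] [Group K] (e : G ≃* K) (S : Set K) :
    BCay G (e ⁻¹' S) ≃g BCay K S where
  toEquiv := e.toEquiv.prodCongr (Equiv.refl _)
  map_rel_iff' := by
    intro u v
    simp [BCay_adj]

theorem IsBCIGroup.of_mulEquiv {G K : Type*} [Group G] [Group K] (e : G ≃* K)
    (hG : IsBCIGroup G) : IsBCIGroup K := by
  rintro S T ⟨f⟩
  obtain ⟨g, α, h⟩ := hG (e ⁻¹' S) (e ⁻¹' T)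
    ⟨((BCay.isoPreimage e S).trans f).trans (BCay.isoPreimage e T).symm⟩
  refine ⟨e g, (e.symm.trans α).trans e, ?_⟩
  rw [← e.surjective.image_preimage T, h, Set.image_image,
    ← e.surjective.image_preimage S, Set.image_image]
  simp [e.injective.preimage_image]

theorem MonoidHom.apply_eq_one_of_coprime_card {G H : Type*} [Group G] [Group H]
    (hco : Nat.Coprime (Nat.card G) (Nat.card H)) (φ : G →* H) (g : G) : φ g = 1 :=
  orderOf_eq_one_iff.mp <| Nat.eq_one_of_dvd_coprimes hco
    ((orderOf_map_dvd φ g).trans (orderOf_dvd_natCard g)) (orderOf_dvd_natCard _)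

theorem IsBCIGroup.fst_of_coprime {G H : Type*} [Group G] [Group H] [Finite G]
    (hco : Nat.Coprime (Nat.card G) (Nat.card H)) (hBCI : IsBCIGroup (G × H)) :
    IsBCIGroup G := by
  rintro S T ⟨f⟩
  obtain ⟨g, α, h⟩ := hBCI (S ×ˢ {1}) (T ×ˢ {1}) ⟨BCay.isoProdOne H f⟩
  let φ : G →* G × H := α.toMonoidHom.comp (MonoidHom.inl G H)
  have hsnd (x : G) : (φ x).2 = 1 :=
    ((MonoidHom.snd G H).comp φ).apply_eq_one_of_coprime_card hco x
  let β : G →* G := (MonoidHom.fst G H).comp φ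
  have hβ : Function.Injective β := fun x y hxy => by
    have : φ x = φ y := Prod.ext hxy ((hsnd x).trans (hsnd y).symm)
    exact congrArg Prod.fst (α.injective this)
  refine ⟨g.1, MulEquiv.ofBijective β (Finite.injective_iff_bijective.mp hβ), ?_⟩
  have hT := congrArg (Set.image Prod.fst) h
  rw [Set.fst_image_prod _ (Set.singleton_nonempty _), Set.image_image, Set.prod_singleton,
    Set.image_image] at hT
  exact hT

/-- If `G × H` is a BCI-group and `(|G|, |H|) = 1`, then both `G` and `H` are BCI-groups. -/
theorem coprime_factors_BCIGroup (G H : Type*) [Group G] [Group H] [Finite G] [Finite H]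
    (hco : Nat.Coprime (Nat.card G) (Nat.card H)) (hBCI : IsBCIGroup (G × H)) :
    IsBCIGroup G ∧ IsBCIGroup H :=
  ⟨hBCI.fst_of_coprime hco, (hBCI.of_mulEquiv MulEquiv.prodComm).fst_of_coprime hco.symm⟩
end

section
/- The alternating group A₅ is not a 4-BCI-group. In particular, for a = (1 2 3) and b = (1 2 3 4 5) in A₅ and S = {1, a, b, ab}, there exist no g ∈ A₅ and α ∈ Aut(A₅) with S⁻¹ = gS^α. -/
open SimpleGraph

/-- Swapping the two parts is an isomorphism from `BCay(G,S)` to `BCay(G,S⁻¹)`. -/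
def BCay.isoInv {G : Type*} [Group G] (S : Set G) : BCay G S ≃g BCay G S⁻¹ where
  toEquiv := Equiv.prodCongr (Equiv.refl G) (Equiv.swap 0 1)
  map_rel_iff' := by
    rintro ⟨x, i⟩ ⟨y, j⟩
    fin_cases i <;> fin_cases j <;> simp [BCay, SimpleGraph.fromRel_adj]

/-- For `S = {1, a, b, ab}` and `g ∈ S⁻¹`, the translate `g⁻¹S⁻¹` contains no element of order `3`
and element of order `5` whose product again lies in it. -/
theorem perm_translate_no_pair (a b : Equiv.Perm (Fin 5)) (ha : a = c[0, 1, 2])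
    (hb : b = c[0, 1, 2, 3, 4]) :
    ∀ g ∈ [1, a⁻¹, b⁻¹, (a * b)⁻¹], ∀ u ∈ [1, a⁻¹, b⁻¹, (a * b)⁻¹],
      ∀ v ∈ [1, a⁻¹, b⁻¹, (a * b)⁻¹], ∀ w ∈ [1, a⁻¹, b⁻¹, (a * b)⁻¹],
      (g⁻¹ * u) ^ 3 = 1 → (g⁻¹ * v) ^ 5 = 1 → g⁻¹ * u ≠ 1 → g⁻¹ * v ≠ 1 →
        (g⁻¹ * u) * (g⁻¹ * v) ≠ g⁻¹ * w := by
  subst ha hb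
  decide +kernel

/-- For `a = (1 2 3)`, `b = (1 2 3 4 5)` and `S = {1, a, b, ab}`, the set `S⁻¹` is not of the
form `gS^α`. -/
theorem inv_ne_translate_of_cycles (a b : alternatingGroup (Fin 5))
    (ha : (a : Equiv.Perm (Fin 5)) = c[0, 1, 2])
    (hb : (b : Equiv.Perm (Fin 5)) = c[0, 1, 2, 3, 4]) :
    ¬ ∃ (g : alternatingGroup (Fin 5))
        (α : alternatingGroup (Fin 5) ≃* alternatingGroup (Fin 5)),
        ({1, a, b, a * b} : Set (alternatingGroup (Fin 5)))⁻¹ =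
          (fun s => g * α s) '' {1, a, b, a * b} := by
  rintro ⟨g, α, h⟩
  have mem : ∀ s ∈ ({1, a, b, a * b} : Set (alternatingGroup (Fin 5))),
      ((g * α s : alternatingGroup (Fin 5)) : Equiv.Perm (Fin 5)) ∈
        [1, (a : Equiv.Perm (Fin 5))⁻¹, (b : Equiv.Perm (Fin 5))⁻¹,
          ((a : Equiv.Perm (Fin 5)) * b)⁻¹] := by
    intro s hs
    have hs' : g * α s ∈ ({1, a, b, a * b} : Set (alternatingGroup (Fin 5)))⁻¹ :=
      h ▸ Set.mem_image_of_mem _ hs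
    simp only [Set.mem_inv, Set.mem_insert_iff, Set.mem_singleton_iff, inv_eq_iff_eq_inv] at hs'
    rcases hs' with e | e | e | e <;> rw [e] <;> simp
  have ha3 : a ^ 3 = 1 := Subtype.ext (by simp only [Subgroup.coe_pow, ha]; decide +kernel)
  have hb5 : b ^ 5 = 1 := Subtype.ext (by simp only [Subgroup.coe_pow, hb]; decide +kernel)
  have ha1 : a ≠ 1 := fun e => absurd (ha.symm.trans (congrArg Subtype.val e)) (by decide)
  have hb1 : b ≠ 1 := fun e => absurd (hb.symm.trans (congrArg Subtype.val e)) (by decide)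
  have hg := mem 1 (by simp)
  rw [map_one, mul_one] at hg
  refine perm_translate_no_pair a b ha hb g hg _ (mem a (by simp)) _ (mem b (by simp))
    _ (mem (a * b) (by simp)) ?_ ?_ ?_ ?_ ?_
  · simpa using congrArg Subtype.val (congrArg α ha3)
  · simpa using congrArg Subtype.val (congrArg α hb5)
  · simpa using ha1
  · simpa using hb1
  · simp

/-- `A₅` is not a 4-BCI-group; in particular for `a = (1 2 3)`, `b = (1 2 3 4 5)` and
`S = {1, a, b, ab}`, there are no `g ∈ A₅` and `α ∈ Aut(A₅)` with `S⁻¹ = gS^α`. -/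
theorem A5_not_four_BCI :
    (¬ IsmBCIGroup (alternatingGroup (Fin 5)) 4) ∧
    (∀ a b : alternatingGroup (Fin 5),
      (a : Equiv.Perm (Fin 5)) = c[0, 1, 2] →
      (b : Equiv.Perm (Fin 5)) = c[0, 1, 2, 3, 4] →
      ¬ ∃ (g : alternatingGroup (Fin 5))
          (α : alternatingGroup (Fin 5) ≃* alternatingGroup (Fin 5)),
          ({1, a, b, a * b} : Set (alternatingGroup (Fin 5)))⁻¹ =
            (fun s => g * α s) '' {1, a, b, a * b}) := by
  refine ⟨fun h => ?_, inv_ne_translate_of_cycles⟩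
  let a : alternatingGroup (Fin 5) := ⟨c[0, 1, 2], Equiv.Perm.mem_alternatingGroup.2 (by decide +kernel)⟩
  let b : alternatingGroup (Fin 5) := ⟨c[0, 1, 2, 3, 4], Equiv.Perm.mem_alternatingGroup.2 (by decide +kernel)⟩
  have hcard : ({1, a, b, a * b} : Set (alternatingGroup (Fin 5))).ncard ≤ 4 := by
    have h₁ := Set.ncard_insert_le 1 ({a, b, a * b} : Set (alternatingGroup (Fin 5)))
    have h₂ := Set.ncard_insert_le a ({b, a * b} : Set (alternatingGroup (Fin 5)))
    have h₃ := Set.ncard_insert_le b ({a * b} : Set (alternatingGroup (Fin 5)))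
    rw [Set.ncard_singleton] at h₃
    omega
  exact inv_ne_translate_of_cycles a b rfl rfl (h _ hcard _ ⟨BCay.isoInv _⟩)
end
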